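/- Let A = (A₁,A₂,A₃,A₄) be a quadruple of matrices in SL(2,ℂ) with A₁A₂A₃A₄ = I which is an SU(2)-class, with trace coordinates a = (a₁,a₂,a₃,a₄) and v = (v₁,v₂,v₃). Then each aᵢ is real and lies in [−2,2], each vⱼ is real, and v₁ ∈ I_{a₁,a₂} ∩ I_{a₃,a₄}, v₂ ∈ I_{a₂,a₃} ∩ I_{a₁,a₄}, v₃ ∈ I_{a₁,a₃} ∩ I_{a₂,a₄}; in particular the intersection I_{a₁,a₂} ∩ I_{a₃,a₄} is nonempty. -/

import Mathlib

open Matrix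

/-- A quadruple of 2×2 complex matrices is an SU(2)-class if some single
`g ∈ GL(2,ℂ)` conjugates all four of them into SU(2). -/
def IsSU2Class (A1 A2 A3 A4 : Matrix (Fin 2) (Fin 2) ℂ) : Prop :=
  ∃ g : GL (Fin 2) ℂ, ∀ B ∈ ({A1, A2, A3, A4} : Set (Matrix (Fin 2) (Fin 2) ℂ)),
    ((g : Matrix (Fin 2) (Fin 2) ℂ) * B * ((g⁻¹ : GL (Fin 2) ℂ) : Matrix (Fin 2) (Fin 2) ℂ))
      ∈ Matrix.unitaryGroup (Fin 2) ℂ ∧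
    ((g : Matrix (Fin 2) (Fin 2) ℂ) * B * ((g⁻¹ : GL (Fin 2) ℂ) : Matrix (Fin 2) (Fin 2) ℂ)).det = 1

/-- A quadruple of 2×2 complex matrices is an SL(2,ℝ)-class if some single
`g ∈ GL(2,ℂ)` conjugates all four of them into matrices with real entries. -/
def IsSL2RClass (A1 A2 A3 A4 : Matrix (Fin 2) (Fin 2) ℂ) : Prop :=
  ∃ g : GL (Fin 2) ℂ, ∀ B ∈ ({A1, A2, A3, A4} : Set (Matrix (Fin 2) (Fin 2) ℂ)),
    ∀ i j, (((g : Matrix (Fin 2) (Fin 2) ℂ) * B *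
      ((g⁻¹ : GL (Fin 2) ℂ) : Matrix (Fin 2) (Fin 2) ℂ)) i j).im = 0
/-- The interval `I_{s,t} = [(st − √((4−s²)(4−t²)))/2, (st + √((4−s²)(4−t²)))/2]`. -/
def Ist (s t : ℝ) : Set ℝ :=
  Set.Icc ((s * t - Real.sqrt ((4 - s ^ 2) * (4 - t ^ 2))) / 2)
          ((s * t + Real.sqrt ((4 - s ^ 2) * (4 - t ^ 2))) / 2)

/-- A special unitary `2 × 2` matrix is a unit quaternion. -/
theorem exists_quaternion_of_mem_SU2 {X : Matrix (Fin 2) (Fin 2) ℂ}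
    (hX : X ∈ specialUnitaryGroup (Fin 2) ℂ) :
    ∃ p q r s : ℝ, p ^ 2 + q ^ 2 + r ^ 2 + s ^ 2 = 1 ∧
      X = !![⟨p, q⟩, ⟨r, s⟩; ⟨-r, s⟩, ⟨p, -q⟩] := by
  obtain ⟨hu, hd⟩ := mem_specialUnitaryGroup_iff.1 hX
  have hadj : star X = X.adjugate := by
    calc star X = star X * (X * X.adjugate) := by rw [mul_adjugate, hd, one_smul, mul_one]
      _ = X.adjugate := by rw [← mul_assoc, (mem_unitaryGroup_iff'.1 hu), one_mul]
  have h00 : star (X 0 0) = X 1 1 := by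
    simpa [star_apply, adjugate_fin_two] using congrFun (congrFun hadj 0) 0
  have h01 : star (X 0 1) = -X 1 0 := by
    simpa [star_apply, adjugate_fin_two] using congrFun (congrFun hadj 1) 0
  have h10 : X 1 0 = -star (X 0 1) := by rw [h01, neg_neg]
  refine ⟨(X 0 0).re, (X 0 0).im, (X 0 1).re, (X 0 1).im, ?_, ?_⟩
  · rw [det_fin_two, ← h00, h10] at hd
    have := congrArg Complex.re hd
    simp at this
    linarith
  · ext i j
    fin_cases i <;> fin_cases j <;> simp [← h00, h10, Complex.ext_iff]

theorem trace_im_of_mem_SU2 {X : Matrix (Fin 2) (Fin 2) ℂ}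
    (hX : X ∈ specialUnitaryGroup (Fin 2) ℂ) : X.trace.im = 0 := by
  obtain ⟨p, q, r, s, -, rfl⟩ := exists_quaternion_of_mem_SU2 hX
  simp [trace_fin_two]

theorem trace_re_mem_Icc_of_mem_SU2 {X : Matrix (Fin 2) (Fin 2) ℂ}
    (hX : X ∈ specialUnitaryGroup (Fin 2) ℂ) : X.trace.re ∈ Set.Icc (-2 : ℝ) 2 := by
  obtain ⟨p, q, r, s, h, rfl⟩ := exists_quaternion_of_mem_SU2 hX
  have hp : |p| ≤ 1 := abs_le_one_iff_mul_self_le_one.2 (by nlinarith)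
  obtain ⟨h₁, h₂⟩ := abs_le.1 hp
  simp only [trace_fin_two, of_apply, cons_val', cons_val_zero, cons_val_one, cons_val_fin_one,
    Complex.add_re, Set.mem_Icc]
  constructor <;> linarith

theorem trace_mul_re_mem_Ist_of_mem_SU2 {X Y : Matrix (Fin 2) (Fin 2) ℂ}
    (hX : X ∈ specialUnitaryGroup (Fin 2) ℂ) (hY : Y ∈ specialUnitaryGroup (Fin 2) ℂ) :
    (X * Y).trace.re ∈ Ist X.trace.re Y.trace.re := by
  obtain ⟨p, q, r, s, h, rfl⟩ := exists_quaternion_of_mem_SU2 hX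
  obtain ⟨p', q', r', s', h', rfl⟩ := exists_quaternion_of_mem_SU2 hY
  have key : |4 * (q * q' + r * r' + s * s')| ≤
      √((4 - (p + p) ^ 2) * (4 - (p' + p') ^ 2)) := by
    apply Real.abs_le_sqrt
    have e : 4 - (p + p) ^ 2 = 4 * (q ^ 2 + r ^ 2 + s ^ 2) := by linear_combination -4 * h
    have e' : 4 - (p' + p') ^ 2 = 4 * (q' ^ 2 + r' ^ 2 + s' ^ 2) := by linear_combination -4 * h'
    rw [e, e']
    linarith [sq_nonneg (q * r' - r * q'), sq_nonneg (q * s' - s * q'),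
      sq_nonneg (r * s' - s * r')]
  obtain ⟨h₁, h₂⟩ := abs_le.1 key
  simp only [Ist, trace_fin_two, mul_apply, Fin.sum_univ_two, of_apply, cons_val', cons_val_zero,
    cons_val_one, cons_val_fin_one, Complex.add_re, Complex.mul_re, Set.mem_Icc]
  constructor <;> linarith

theorem trace_eq_of_mul_eq_one {X Y : Matrix (Fin 2) (Fin 2) ℂ} (hX : X.det = 1)
    (h : X * Y = 1) : X.trace = Y.trace := by
  have hY : Y = X.adjugate := by
    calc Y = X.adjugate * X * Y := by rw [adjugate_mul, hX, one_smul, one_mul]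
      _ = X.adjugate := by rw [mul_assoc, h, mul_one]
  rw [hY, adjugate_fin_two, trace_fin_two, trace_fin_two]
  simp [add_comm]

theorem trace_mul_re_mem_Ist_of_mul_eq_one {X Y Z : Matrix (Fin 2) (Fin 2) ℂ}
    (hX : X ∈ specialUnitaryGroup (Fin 2) ℂ) (hY : Y ∈ specialUnitaryGroup (Fin 2) ℂ)
    (hZ : Z.det = 1) (h : Z * (X * Y) = 1) :
    Z.trace.re ∈ Ist X.trace.re Y.trace.re :=
  trace_eq_of_mul_eq_one hZ h ▸ trace_mul_re_mem_Ist_of_mem_SU2 hX hY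

theorem trace_coordinates_of_mem_SU2 {B1 B2 B3 B4 : Matrix (Fin 2) (Fin 2) ℂ}
    (h1 : B1 ∈ specialUnitaryGroup (Fin 2) ℂ) (h2 : B2 ∈ specialUnitaryGroup (Fin 2) ℂ)
    (h3 : B3 ∈ specialUnitaryGroup (Fin 2) ℂ) (h4 : B4 ∈ specialUnitaryGroup (Fin 2) ℂ)
    (hprod : B1 * B2 * B3 * B4 = 1) :
    (B1 * B2).trace.re ∈ Ist B1.trace.re B2.trace.re ∩ Ist B3.trace.re B4.trace.re ∧
    (B2 * B3).trace.re ∈ Ist B2.trace.re B3.trace.re ∩ Ist B1.trace.re B4.trace.re ∧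
    (B1 * B3).trace.re ∈ Ist B1.trace.re B3.trace.re ∩ Ist B2.trace.re B4.trace.re := by
  have d {X : Matrix (Fin 2) (Fin 2) ℂ} (hX : X ∈ specialUnitaryGroup (Fin 2) ℂ) : X.det = 1 :=
    (mem_specialUnitaryGroup_iff.1 hX).2
  have hs : star B1 ∈ specialUnitaryGroup (Fin 2) ℂ :=
    (star (⟨B1, h1⟩ : specialUnitaryGroup (Fin 2) ℂ)).2
  have hs1 : star B1 * B1 = 1 :=
    mem_unitaryGroup_iff'.1 (mem_specialUnitaryGroup_iff.1 h1).1
  refine ⟨⟨trace_mul_re_mem_Ist_of_mem_SU2 h1 h2, ?_⟩,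
    ⟨trace_mul_re_mem_Ist_of_mem_SU2 h2 h3, ?_⟩, ⟨trace_mul_re_mem_Ist_of_mem_SU2 h1 h3, ?_⟩⟩
  · exact trace_mul_re_mem_Ist_of_mul_eq_one h3 h4 (d (mul_mem h1 h2))
      (by simpa only [mul_assoc] using hprod)
  · have h := trace_eq_of_mul_eq_one (Y := B4 * B1) (d (mul_mem h2 h3)) <| by
      rw [← mul_assoc, mul_eq_one_comm]
      simpa only [mul_assoc] using hprod
    rw [h, trace_mul_comm]
    exact trace_mul_re_mem_Ist_of_mem_SU2 h1 h4
  · have hconj : (B1 * B2 * star B1).trace = B2.trace := by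
      rw [trace_mul_comm, ← mul_assoc, hs1, one_mul]
    have h := trace_eq_of_mul_eq_one (Y := B4 * (B1 * B2 * star B1)) (d (mul_mem h1 h3)) <| by
      rw [← mul_assoc, mul_eq_one_comm]
      calc B1 * B2 * star B1 * (B1 * B3 * B4) = B1 * B2 * (star B1 * B1) * B3 * B4 := by
            simp only [mul_assoc]
        _ = 1 := by rw [hs1, mul_one, hprod]
    rw [h, trace_mul_comm, ← hconj]
    exact trace_mul_re_mem_Ist_of_mem_SU2 (mul_mem (mul_mem h1 h2) hs) h4

/-- The trace coordinates of an SU(2)-class quadruple are real, the `aᵢ` lie in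
`[-2,2]`, and each `vⱼ` lies in the corresponding intersection of intervals
`I_{s,t}`; in particular `I_{a₁,a₂} ∩ I_{a₃,a₄}` is nonempty. -/
theorem su2_class_trace_coordinates
    (A1 A2 A3 A4 : Matrix (Fin 2) (Fin 2) ℂ)
    (h1 : A1.det = 1) (h2 : A2.det = 1) (h3 : A3.det = 1) (h4 : A4.det = 1)
    (hprod : A1 * A2 * A3 * A4 = 1)
    (hsu2 : IsSU2Class A1 A2 A3 A4) :
    (A1.trace.im = 0 ∧ A2.trace.im = 0 ∧ A3.trace.im = 0 ∧ A4.trace.im = 0) ∧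
    (A1.trace.re ∈ Set.Icc (-2 : ℝ) 2 ∧ A2.trace.re ∈ Set.Icc (-2 : ℝ) 2 ∧
     A3.trace.re ∈ Set.Icc (-2 : ℝ) 2 ∧ A4.trace.re ∈ Set.Icc (-2 : ℝ) 2) ∧
    ((A1 * A2).trace.im = 0 ∧ (A2 * A3).trace.im = 0 ∧ (A1 * A3).trace.im = 0) ∧
    (A1 * A2).trace.re ∈ Ist A1.trace.re A2.trace.re ∩ Ist A3.trace.re A4.trace.re ∧
    (A2 * A3).trace.re ∈ Ist A2.trace.re A3.trace.re ∩ Ist A1.trace.re A4.trace.re ∧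
    (A1 * A3).trace.re ∈ Ist A1.trace.re A3.trace.re ∩ Ist A2.trace.re A4.trace.re ∧
    (Ist A1.trace.re A2.trace.re ∩ Ist A3.trace.re A4.trace.re).Nonempty := by
  obtain ⟨g, hg⟩ := hsu2
  let c (B : Matrix (Fin 2) (Fin 2) ℂ) : Matrix (Fin 2) (Fin 2) ℂ := g.1 * B * (g⁻¹).1
  have hinv : (g⁻¹).1 * g.1 = 1 := g.inv_mul
  have hmul (X Y : Matrix (Fin 2) (Fin 2) ℂ) : c X * c Y = c (X * Y) := by
    calc c X * c Y = g.1 * X * ((g⁻¹).1 * g.1) * Y * (g⁻¹).1 := by simp only [c, mul_assoc]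
      _ = c (X * Y) := by rw [hinv, mul_one, mul_assoc g.1]
  have htr (X : Matrix (Fin 2) (Fin 2) ℂ) : (c X).trace = X.trace := by
    rw [trace_mul_comm, ← mul_assoc, hinv, one_mul]
  have hc : ∀ B ∈ ({A1, A2, A3, A4} : Set (Matrix (Fin 2) (Fin 2) ℂ)),
      c B ∈ specialUnitaryGroup (Fin 2) ℂ :=
    fun B hB => mem_specialUnitaryGroup_iff.2 (hg B hB)
  have m1 := hc A1 (by simp)
  have m2 := hc A2 (by simp)
  have m3 := hc A3 (by simp)
  have m4 := hc A4 (by simp)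
  have hone : c A1 * c A2 * c A3 * c A4 = 1 := by
    rw [hmul, hmul, hmul, hprod]
    simp only [c, mul_one]
    exact g.mul_inv
  have hv := trace_coordinates_of_mem_SU2 m1 m2 m3 m4 hone
  have him {X : Matrix (Fin 2) (Fin 2) ℂ} (hX : c X ∈ specialUnitaryGroup (Fin 2) ℂ) :
      X.trace.im = 0 := htr X ▸ trace_im_of_mem_SU2 hX
  have hre {X : Matrix (Fin 2) (Fin 2) ℂ} (hX : c X ∈ specialUnitaryGroup (Fin 2) ℂ) :
      X.trace.re ∈ Set.Icc (-2 : ℝ) 2 := htr X ▸ trace_re_mem_Icc_of_mem_SU2 hX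
  simp only [hmul, htr] at hv
  exact ⟨⟨him m1, him m2, him m3, him m4⟩, ⟨hre m1, hre m2, hre m3, hre m4⟩,
    ⟨him (hmul A1 A2 ▸ mul_mem m1 m2), him (hmul A2 A3 ▸ mul_mem m2 m3),
      him (hmul A1 A3 ▸ mul_mem m1 m3)⟩, hv.1, hv.2.1, hv.2.2, ⟨_, hv.1⟩⟩
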